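/- Let Z be a Gaussian random vector in R^n with mean μ ≠ 0 (or μ = 0) and positive definite covariance Σ with largest eigenvalue σ_max, and let M > 0, p ∈ (0,1), μ_χ(p) the χ²(n) quantile. Suppose W is a random vector with ‖W₁ − W₂‖₂ ≥ (1/M)‖V₁ − V₂‖₂ replaced appropriately: formally, suppose Y₀, Y ∈ R^n are random vectors such that Φ(Y₀) − Φ(Y) = Z where Φ satisfies ‖Φ(a) − Φ(b)‖₂ ≥ (1/M)‖a − b‖₂ for all a, b. Then P(‖Y₀ − Y‖₂ ≤ M(√(μ_χ(p) σ_max) + ‖μ‖₂)) ≥ p. -/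

import Mathlib

open MeasureTheory ProbabilityTheory Matrix

/-- A measure on `ι → ℝ` is (multivariate) Gaussian with mean `m` and covariance `K`
iff every linear functional pushes it forward to a real Gaussian. -/
def IsGaussianVec {ι : Type*} [Fintype ι] (μ : Measure (ι → ℝ)) (m : ι → ℝ)
    (K : Matrix ι ι ℝ) : Prop :=
  ∀ a : ι → ℝ, μ.map (fun x => ∑ i, a i * x i)
    = gaussianReal (∑ i, a i * m i) (∑ i, ∑ j, a i * K i j * a j).toNNReal

/-- The chi-squared distribution with `n` degrees of freedom, as a Gamma distribution. -/
noncomputable def chiSqMeasure (n : ℕ) : Measure ℝ := gammaMeasure (n / 2 : ℝ) (1 / 2 : ℝ)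

/-- Euclidean (ℓ²) norm of a vector in `Fin n → ℝ`. -/
noncomputable def l2norm {n : ℕ} (v : Fin n → ℝ) : ℝ := Real.sqrt (∑ i, v i ^ 2)

theorem chi_charFun {n : ℕ} (hn : 0 < n) :
    ∃ C : ℂ, ∀ t : ℝ,
      charFun ((Measure.pi (fun _ : Fin n => gaussianReal 0 1)).map (fun x => ∑ i, x i ^ 2)) t
        = C * charFun (chiSqMeasure n) t := by
  have : Nonempty (Fin n) := ⟨⟨0, hn⟩⟩
  have hn2 : (0:ℝ) < n / 2 := by positivity
  -- the Gaussian side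
  have key : ∃ C : ℂ, ∀ t : ℝ,
      charFun ((Measure.pi (fun _ : Fin n => gaussianReal 0 1)).map (fun x => ∑ i, x i ^ 2)) t
        = C * ∫ s in Set.Ioi (0:ℝ), ((s ^ ((n:ℝ) / 2 - 1) : ℝ) : ℂ) *
            Complex.exp (-(1/2 - t * Complex.I) * s) := by
    set c : ℂ := (((Real.sqrt (2 * Real.pi))⁻¹ : ℝ) : ℂ) with hc
    refine ⟨c ^ n * (n * (volume.real (Metric.ball (0 : EuclideanSpace ℝ (Fin n)) 1)) * (1/2)),
      fun t => ?_⟩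
    have h1 : ∀ x : ℝ, gaussianPDFReal 0 1 x • Complex.exp (t * ((x ^ 2 : ℝ) : ℂ) * Complex.I)
        = c * Complex.exp (-(1/2 - t * Complex.I) * (x:ℂ)^2) := by
      intro x
      rw [gaussianPDFReal, hc, Complex.real_smul]
      push_cast
      rw [mul_assoc, ← Complex.exp_add]
      congr 2
      · simp
      · simp; ring
    rw [charFun_apply_real, integral_map (Measurable.aemeasurable (by fun_prop)) (by fun_prop)]
    have h2 : ∀ x : Fin n → ℝ, Complex.exp (t * ((∑ i, x i ^ 2 : ℝ) : ℂ) * Complex.I)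
        = ∏ i, Complex.exp (t * ((x i ^ 2 : ℝ) : ℂ) * Complex.I) := by
      intro x
      rw [← Complex.exp_sum]
      push_cast
      rw [Finset.mul_sum, Finset.sum_mul]
    simp_rw [h2]
    rw [integral_fintype_prod_eq_prod (fun _ x => Complex.exp (t * ((x ^ 2 : ℝ) : ℂ) * Complex.I))]
    simp_rw [integral_gaussianReal_eq_integral_smul (one_ne_zero), h1]
    rw [← integral_fintype_prod_eq_prod
      (fun _ x => c * Complex.exp (-(1/2 - t * Complex.I) * ((x:ℝ):ℂ)^2))]
    have h3 : ∀ x : Fin n → ℝ, ∏ i, c * Complex.exp (-(1/2 - t * Complex.I) * (x i:ℂ)^2)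
        = (fun r : ℝ => c ^ n * Complex.exp (-(1/2 - t * Complex.I) * (r:ℂ)^2))
          ‖WithLp.toLp 2 x‖ := by
      intro x
      rw [Finset.prod_mul_distrib, ← Complex.exp_sum]
      simp only [Finset.prod_const, Finset.card_univ, Fintype.card_fin]
      have e := EuclideanSpace.norm_sq_eq (WithLp.toLp 2 x)
      simp only [Real.norm_eq_abs, sq_abs] at e
      rw [← Finset.mul_sum, ← Complex.ofReal_pow ‖_‖, e]
      simp
    simp_rw [h3]
    rw [← volume_pi, (PiLp.volume_preserving_toLp (Fin n)).integral_comp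
      (MeasurableEquiv.toLp 2 (Fin n → ℝ)).measurableEmbedding
      (fun y => (fun r : ℝ => c ^ n * Complex.exp (-(1/2 - t * Complex.I) * (r:ℂ)^2)) ‖y‖),
      integral_fun_norm_addHaar (E := EuclideanSpace ℝ (Fin n)) volume
      (fun r : ℝ => c ^ n * Complex.exp (-(1/2 - t * Complex.I) * (r:ℂ)^2))]
    rw [← integral_comp_rpow_Ioi_of_pos (p := 2)
      (g := fun s : ℝ => ((s ^ ((n:ℝ) / 2 - 1) : ℝ) : ℂ) *
            Complex.exp (-(1/2 - t * Complex.I) * s)) (by norm_num)]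
    have h4 : ∀ x ∈ Set.Ioi (0:ℝ), (2 * x ^ ((2:ℝ) - 1)) •
        ((((x ^ (2:ℝ)) ^ ((n:ℝ) / 2 - 1) : ℝ) : ℂ) *
            Complex.exp (-(1/2 - t * Complex.I) * ((x ^ (2:ℝ) : ℝ) : ℂ)))
        = 2 * (((x ^ (n - 1) : ℝ) : ℂ) * Complex.exp (-(1/2 - t * Complex.I) * (x:ℂ)^2)) := by
      intro x hx
      have hx : 0 < x := hx
      have e : x ^ (n - 1) = x ^ ((2:ℝ) - 1) * (x ^ (2:ℝ)) ^ ((n:ℝ) / 2 - 1) := by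
        rw [← Real.rpow_mul hx.le, ← Real.rpow_add hx, ← Real.rpow_natCast, Nat.cast_sub hn]
        congr 1
        push_cast; ring
      rw [e, Complex.real_smul]
      push_cast
      rw [Real.rpow_two]
      push_cast
      ring
    rw [setIntegral_congr_fun measurableSet_Ioi h4, integral_const_mul]
    simp only [finrank_euclideanSpace, Fintype.card_fin, Complex.real_smul, nsmul_eq_mul]
    have h5 : ∀ x : ℝ, ((x ^ (n-1) : ℝ):ℂ) * (c ^ n * Complex.exp (-(1/2 - t * Complex.I) * (x:ℂ)^2))
       = c ^ n * (((x ^ (n - 1) : ℝ) : ℂ) * Complex.exp (-(1/2 - t * Complex.I) * (x:ℂ)^2)) := by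
      intro x; ring
    simp_rw [h5]
    rw [integral_const_mul]
    ring
  obtain ⟨C, hC⟩ := key
  set D : ℂ := ((((1/2:ℝ) ^ ((n:ℝ)/2) / Real.Gamma ((n:ℝ)/2) : ℝ)) : ℂ) with hD
  have hD0 : D ≠ 0 := by
    rw [hD]
    have := Real.Gamma_pos_of_pos hn2
    exact_mod_cast (by positivity : (0:ℝ) < (1/2:ℝ) ^ ((n:ℝ)/2) / Real.Gamma ((n:ℝ)/2)).ne'
  refine ⟨C * D⁻¹, fun t => ?_⟩
  rw [hC, mul_assoc]
  congr 1
  rw [eq_inv_mul_iff_mul_eq₀ hD0, charFun_apply_real, chiSqMeasure, gammaMeasure,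
    integral_withDensity_eq_integral_toReal_smul
      (by unfold gammaPDF; fun_prop) (by simp [gammaPDF]),
    ← integral_const_mul, ← integral_Ici_eq_integral_Ioi, ← integral_indicator measurableSet_Ici]
  congr 1
  ext x
  rw [gammaPDF, ENNReal.toReal_ofReal (gammaPDFReal_nonneg hn2 (by norm_num) x), gammaPDFReal]
  by_cases hx : 0 ≤ x
  · rw [Set.indicator_of_mem (by exact hx), if_pos hx, Complex.real_smul, hD]
    push_cast
    rw [mul_assoc (_ * _), ← Complex.exp_add]
    rw [← mul_assoc]
    congr 2
    ring
  · rw [Set.indicator_of_notMem (by simpa using hx), if_neg hx, zero_smul]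

theorem chi_law {n : ℕ} (hn : 0 < n) :
    (Measure.pi (fun _ : Fin n => gaussianReal 0 1)).map (fun x => ∑ i, x i ^ 2)
      = chiSqMeasure n := by
  obtain ⟨C, hC⟩ := chi_charFun hn
  have hn2 : (0:ℝ) < n / 2 := by positivity
  have i1 : IsProbabilityMeasure (chiSqMeasure n) :=
    isProbabilityMeasure_gammaMeasure hn2 (by norm_num)
  have i2 : IsProbabilityMeasure
      ((Measure.pi (fun _ : Fin n => gaussianReal 0 1)).map (fun x => ∑ i, x i ^ 2)) :=
    Measure.isProbabilityMeasure_map (Measurable.aemeasurable (by fun_prop))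
  have hC1 : C = 1 := by
    have := hC 0
    simpa using this.symm
  apply Measure.ext_of_charFun
  ext t
  rw [hC, hC1, one_mul]

theorem whiten {n : ℕ} (ν : Measure (Fin n → ℝ)) [IsProbabilityMeasure ν] (m : Fin n → ℝ)
    (S : Matrix (Fin n) (Fin n) ℝ) (hS : S.PosDef) (hG : IsGaussianVec ν m S) :
    ν.map (fun x j => ∑ i, (hS.1.eigenvectorBasis j i / Real.sqrt (hS.1.eigenvalues j))
      * (x i - m i)) = Measure.pi (fun _ => gaussianReal 0 1) := by
  set b := hS.1.eigenvectorBasis with hb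
  set l := hS.1.eigenvalues with hl
  have hlpos : ∀ j, 0 < l j := hS.eigenvalues_pos
  have i2 : IsProbabilityMeasure (ν.map (fun x j => ∑ i, (b j i / Real.sqrt (l j))
      * (x i - m i))) := Measure.isProbabilityMeasure_map (Measurable.aemeasurable (by fun_prop))
  refine charFun_eq_pi_iff.1 fun t => ?_
  set a : Fin n → ℝ := fun i => ∑ j, t j / Real.sqrt (l j) * b j i with ha
  have hv : ∑ i, ∑ j, a i * S i j * a j = ∑ j, t j ^ 2 := by
    have hSb : ∀ k i, ∑ j, S i j * b k j = l k * b k i := by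
      intro k i
      have := congrFun (hS.1.mulVec_eigenvectorBasis k) i
      simpa [Matrix.mulVec, dotProduct] using this
    have hon : ∀ j k, ∑ i, b j i * b k i = if j = k then 1 else 0 := by
      intro j k
      have := orthonormal_iff_ite.1 b.orthonormal k j
      simp only [PiLp.inner_apply, RCLike.inner_apply, conj_trivial] at this
      rw [this]; simp [eq_comm]
    have h1 : ∀ i, ∑ j, S i j * a j = ∑ k, t k * Real.sqrt (l k) * b k i := by
      intro i
      simp only [ha, Finset.mul_sum]
      rw [Finset.sum_comm]
      refine Finset.sum_congr rfl fun k _ => ?_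
      have : ∀ j, S i j * (t k / Real.sqrt (l k) * b k j)
        = t k / Real.sqrt (l k) * (S i j * b k j) := fun j => by ring
      simp_rw [this]
      rw [← Finset.mul_sum, hSb]
      have h := Real.mul_self_sqrt (hlpos k).le
      have h' := (Real.sqrt_pos.2 (hlpos k)).ne'
      field_simp
      rw [sq, h]
    have h2 : ∀ i, ∑ j, a i * S i j * a j = ∑ j, ∑ k, 
        (t j / Real.sqrt (l j) * (t k * Real.sqrt (l k))) * (b j i * b k i) := by
      intro i
      simp_rw [mul_assoc (a i)]
      rw [← Finset.mul_sum, h1, ha, Finset.sum_mul_sum]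
      refine Finset.sum_congr rfl fun j _ => Finset.sum_congr rfl fun k _ => ?_
      ring
    simp_rw [h2]
    rw [Finset.sum_comm]
    refine Finset.sum_congr rfl fun j _ => ?_
    rw [Finset.sum_comm]
    simp_rw [← Finset.mul_sum, hon]
    have h' := (Real.sqrt_pos.2 (hlpos j)).ne'
    simp
    field_simp
  have hlin : ∀ x : Fin n → ℝ, ∑ j, (∑ i, (b j i / Real.sqrt (l j)) * (x i - m i)) * t j
      = ∑ i, a i * x i - ∑ i, a i * m i := by
    intro x
    rw [← Finset.sum_sub_distrib]
    simp_rw [← mul_sub, ha, Finset.sum_mul]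
    rw [Finset.sum_comm]
    refine Finset.sum_congr rfl fun j _ => Finset.sum_congr rfl fun k _ => ?_
    ring
  have hcf : ∫ x, Complex.exp (((∑ i, a i * x i : ℝ) : ℂ) * Complex.I) ∂ν
      = Complex.exp (((∑ i, a i * m i : ℝ) : ℂ) * Complex.I - ((∑ j, t j ^ 2 : ℝ) : ℂ) / 2) := by
    have h := charFun_gaussianReal (μ := ∑ i, a i * m i)
      (v := (∑ i, ∑ j, a i * S i j * a j).toNNReal) 1
    rw [← hG a, charFun_apply_real, integral_map (Measurable.aemeasurable (by fun_prop)) (by fun_prop), hv] at h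
    have hnn : (0:ℝ) ≤ ∑ j, t j ^ 2 := by positivity
    have e : (((∑ j, t j ^ 2).toNNReal : ℝ) : ℂ) = ((∑ j, t j ^ 2 : ℝ) : ℂ) := by
      rw [Real.coe_toNNReal _ hnn]
    rw [e] at h
    simpa using h
  rw [charFun_apply, integral_map (Measurable.aemeasurable (by fun_prop)) (by fun_prop),
    integral_map (Measurable.aemeasurable (by fun_prop)) (by fun_prop)]
  have h6 : ∀ x : Fin n → ℝ, inner ℝ (WithLp.toLp 2 (fun j => ∑ i, (b j i / Real.sqrt (l j))
      * (x i - m i))) t = ∑ i, a i * x i - ∑ i, a i * m i := by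
    intro x
    rw [← hlin, PiLp.inner_apply]
    simp [mul_comm]
  simp_rw [h6, charFun_gaussianReal, Complex.ofReal_sub, sub_mul, Complex.exp_sub]
  rw [integral_div, hcf, ← Complex.exp_sub, Finset.prod_div_distrib, ← Complex.exp_sum,
     ← Complex.exp_sum, ← Complex.exp_sub]
  congr 1
  simp [Finset.sum_div]

theorem l2norm_eq {n : ℕ} (v : Fin n → ℝ) : l2norm v = ‖WithLp.toLp 2 v‖ := by
  rw [EuclideanSpace.norm_eq, l2norm]
  simp

theorem quad_bound {n : ℕ} (m : Fin n → ℝ)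
    (S : Matrix (Fin n) (Fin n) ℝ) (hS : S.PosDef) (s : ℝ)
    (hs : ∀ j, hS.1.eigenvalues j ≤ s) (x : Fin n → ℝ) :
    ∑ i, (x i - m i) ^ 2 ≤ s * ∑ j, (∑ i, (hS.1.eigenvectorBasis j i / 
      Real.sqrt (hS.1.eigenvalues j)) * (x i - m i)) ^ 2 := by
  set b := hS.1.eigenvectorBasis with hb
  set l := hS.1.eigenvalues with hl
  have hlpos : ∀ j, 0 < l j := hS.eigenvalues_pos
  have h := b.sum_sq_norm_inner_right (WithLp.toLp 2 (x - m))
  rw [EuclideanSpace.norm_sq_eq] at h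
  simp only [PiLp.inner_apply, RCLike.inner_apply, conj_trivial, Real.norm_eq_abs, sq_abs,
    Pi.sub_apply] at h
  rw [← h, Finset.mul_sum]
  refine Finset.sum_le_sum fun j _ => ?_
  have e : ∑ i, (x i - m i) * b j i = Real.sqrt (l j) *
      ∑ i, (b j i / Real.sqrt (l j)) * (x i - m i) := by
    rw [Finset.mul_sum]
    refine Finset.sum_congr rfl fun i _ => ?_
    have h' := (Real.sqrt_pos.2 (hlpos j)).ne'
    field_simp
  rw [e, mul_pow, Real.sq_sqrt (hlpos j).le]
  exact mul_le_mul_of_nonneg_right (hs j) (sq_nonneg _)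

/-- Core probabilistic bound of Lemma 3: if `Φ(Y₀) − Φ(Y) = Z ~ N(μ, Σ)` with `Σ ≻ 0`,
largest eigenvalue `σ_max`, `Φ` inverse-Lipschitz with constant `1/M`, and `μ_χ(p)` the
χ²(n) quantile at level `p`, then
`P(‖Y₀ − Y‖₂ ≤ M(√(μ_χ(p) σ_max) + ‖μ‖₂)) ≥ p`. -/
theorem chance_constraint_bound
    {Ω : Type*} [MeasurableSpace Ω] (P : Measure Ω) [IsProbabilityMeasure P]
    {n : ℕ} (Z Y₀ Y : Ω → (Fin n → ℝ)) (hZ : Measurable Z)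
    (μv : Fin n → ℝ) (Sig : Matrix (Fin n) (Fin n) ℝ) (hSig : Sig.PosDef)
    (σmax : ℝ) (hσmax : IsGreatest (Set.range hSig.1.eigenvalues) σmax)
    (M p μχ : ℝ) (hM : 0 < M) (hp : p ∈ Set.Ioo (0 : ℝ) 1)
    (hG : IsGaussianVec (P.map Z) μv Sig)
    (hquant : chiSqMeasure n (Set.Iic μχ) = ENNReal.ofReal p)
    (Φ : (Fin n → ℝ) → (Fin n → ℝ))
    (hΦ : ∀ a b, (1 / M) * l2norm (a - b) ≤ l2norm (Φ a - Φ b))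
    (hZY : ∀ ω, Φ (Y₀ ω) - Φ (Y ω) = Z ω) :
    ENNReal.ofReal p ≤
      P {ω | l2norm (Y₀ ω - Y ω) ≤ M * (Real.sqrt (μχ * σmax) + l2norm μv)} := by

  obtain ⟨⟨j0, -⟩, hub⟩ := hσmax
  have hn : 0 < n := j0.pos
  have hs : ∀ j, hSig.1.eigenvalues j ≤ σmax := fun j => hub ⟨j, rfl⟩
  have hs0 : 0 < σmax := (hSig.eigenvalues_pos j0).trans_le (hs j0)
  have iP : IsProbabilityMeasure (P.map Z) := Measure.isProbabilityMeasure_map hZ.aemeasurable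
  have hw := whiten (P.map Z) μv Sig hSig hG
  rw [← hquant, ← chi_law hn, ← hw, Measure.map_map (by fun_prop) (by fun_prop),
    Measure.map_map (by fun_prop) hZ, Measure.map_apply (by fun_prop) measurableSet_Iic]
  refine measure_mono fun ω hω => ?_
  simp only [Set.mem_preimage, Function.comp_apply, Set.mem_Iic] at hω
  have hq := quad_bound μv Sig hSig σmax hs (Z ω)
  have h1 : l2norm (Z ω - μv) ≤ Real.sqrt (μχ * σmax) := by
    refine Real.sqrt_le_sqrt ?_
    simp only [Pi.sub_apply]
    refine hq.trans ?_
    rw [mul_comm]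
    exact mul_le_mul_of_nonneg_right hω hs0.le
  have h2 : l2norm (Z ω) ≤ l2norm (Z ω - μv) + l2norm μv := by
    simp only [l2norm_eq]
    refine le_trans (le_of_eq ?_) (norm_add_le _ _)
    rw [← WithLp.toLp_add, sub_add_cancel]
  have h3 := hΦ (Y₀ ω) (Y ω)
  rw [hZY, one_div, inv_mul_le_iff₀ hM] at h3
  exact h3.trans (mul_le_mul_of_nonneg_left (by linarith) hM.le)
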